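/- Let X be a complete CAT(κ) space with κ < 0 and K ⊆ X a nonempty closed convex subset. Then K has the fixed point property for nonexpansive mappings T: K → K if and only if K is geodesically bounded. -/

import Mathlib

/-- `p` lies on a geodesic segment between `x` and `y`. -/
def MetricBtw {X : Type*} [MetricSpace X] (x p y : X) : Prop :=
  dist x p + dist p y = dist x y

/-- `X` is a geodesic metric space: any two points are joined by a segment,
realized pointwise at every ratio `t ∈ [0,1]`. -/
def IsGeodesicSpace (X : Type*) [MetricSpace X] : Prop :=
  ∀ x y : X, ∀ t : ℝ, t ∈ Set.Icc (0 : ℝ) 1 →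
    ∃ p : X, dist x p = t * dist x y ∧ MetricBtw x p y

/-- A subset is (geodesically) convex. -/
def MetricConvex {X : Type*} [MetricSpace X] (K : Set X) : Prop :=
  ∀ x ∈ K, ∀ y ∈ K, ∀ p : X, MetricBtw x p y → p ∈ K

/-- The CAT(-1) comparison inequality: distances between points on the sides of a
triangle are bounded by the corresponding distances in a comparison triangle in the
hyperbolic plane `ℍ²` (the upper half-plane with its hyperbolic metric). -/
def IsCatMinusOne (X : Type*) [MetricSpace X] : Prop :=
  ∀ x y z p q : X, MetricBtw x p y → MetricBtw x q z →
    ∀ x' y' z' p' q' : UpperHalfPlane,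
      dist x' y' = dist x y → dist x' z' = dist x z → dist y' z' = dist y z →
      MetricBtw x' p' y' → dist x' p' = dist x p →
      MetricBtw x' q' z' → dist x' q' = dist x q →
      dist p q ≤ dist p' q'

/-- The CAT(0) comparison inequality (comparison triangles in the Euclidean plane). -/
def IsCatZero (X : Type*) [MetricSpace X] : Prop :=
  ∀ x y z p q : X, MetricBtw x p y → MetricBtw x q z →
    ∀ x' y' z' p' q' : EuclideanSpace ℝ (Fin 2),
      dist x' y' = dist x y → dist x' z' = dist x z → dist y' z' = dist y z →
      MetricBtw x' p' y' → dist x' p' = dist x p →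
      MetricBtw x' q' z' → dist x' q' = dist x q →
      dist p q ≤ dist p' q'

/-- The CAT(κ) comparison inequality for `κ < 0`: the model space `M²_κ` is the
hyperbolic plane with distance multiplied by `1/√(-κ)`, so comparison triangles in
`ℍ²` have side lengths `√(-κ)` times those in `X`. -/
def IsCatNeg (κ : ℝ) (X : Type*) [MetricSpace X] : Prop :=
  ∀ x y z p q : X, MetricBtw x p y → MetricBtw x q z →
    ∀ x' y' z' p' q' : UpperHalfPlane,
      dist x' y' = Real.sqrt (-κ) * dist x y →
      dist x' z' = Real.sqrt (-κ) * dist x z →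
      dist y' z' = Real.sqrt (-κ) * dist y z →
      MetricBtw x' p' y' → dist x' p' = Real.sqrt (-κ) * dist x p →
      MetricBtw x' q' z' → dist x' q' = Real.sqrt (-κ) * dist x q →
      Real.sqrt (-κ) * dist p q ≤ dist p' q'

/-- The CAT(κ) condition for `κ ≤ 0`. -/
def IsCatK (κ : ℝ) (X : Type*) [MetricSpace X] : Prop :=
  if κ < 0 then IsCatNeg κ X else IsCatZero X

/-- Euclidean comparison angle determined by the three side lengths. -/
noncomputable def compAngle (a b c : ℝ) : ℝ :=
  Real.arccos ((a ^ 2 + b ^ 2 - c ^ 2) / (2 * a * b))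

/-- The Alexandrov angle at `x` between `y` and `z`, defined (as is valid in CAT(0)
spaces) as the infimum of Euclidean comparison angles over points on the segments. -/
noncomputable def alexAngle {X : Type*} [MetricSpace X] (x y z : X) : ℝ :=
  sInf {θ : ℝ | ∃ p q : X, MetricBtw x p y ∧ MetricBtw x q z ∧ p ≠ x ∧ q ≠ x ∧
    θ = compAngle (dist x p) (dist x q) (dist p q)}

/-- `K` is geodesically bounded: it contains no geodesic ray. -/
def GeodesicallyBounded {X : Type*} [MetricSpace X] (K : Set X) : Prop :=
  ¬ ∃ c : ℝ → X, (∀ s t : ℝ, 0 ≤ s → 0 ≤ t → dist (c s) (c t) = |s - t|) ∧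
      ∀ t : ℝ, 0 ≤ t → c t ∈ K

open Real in
lemma hyp_triangle (a c L : ℝ) (ha : 0 ≤ a) (hc : 0 ≤ c) (hL : 0 < L)
    (h1 : a ≤ L + c) (h2 : c ≤ L + a) (h3 : L ≤ a + c) :
    ∃ (u v : ℝ), 0 < v ∧ u ^ 2 + v ^ 2 + 1 = 2 * v * cosh a ∧
      u ^ 2 + v ^ 2 + exp L ^ 2 = 2 * v * exp L * cosh c := by
  have eL : 1 < exp L := by simpa using hL
  have hden : 0 < exp L * cosh c - cosh a := by
    have : cosh a ≤ cosh (L + c) := by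
      rw [cosh_le_cosh, abs_of_nonneg ha, abs_of_nonneg (by positivity)]; exact h1
    rw [cosh_add] at this
    have e : exp L = cosh L + sinh L := (cosh_add_sinh L).symm
    have hs := sinh_lt_cosh c
    have hsL : 0 < sinh L := by simpa using hL
    rw [e]; nlinarith
  set q := exp L * cosh c - cosh a with hq
  set v := (exp L ^ 2 - 1) / (2 * q) with hv
  have hvq : 2 * v * q = exp L ^ 2 - 1 := by rw [hv]; field_simp
  have hvpos : 0 < v := by rw [hv]; apply div_pos <;> nlinarith
  have hu : 0 ≤ 2 * v * cosh a - 1 - v ^ 2 := by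
    have key : 0 ≤ 4 * q ^ 2 * (2 * v * cosh a - 1 - v ^ 2) := by
      have e1 : 4 * q ^ 2 * (2 * v * cosh a - 1 - v ^ 2) =
        4 * (exp L ^ 2 - 1) * q * cosh a - 4 * q ^ 2 - (exp L ^ 2 - 1) ^ 2 := by
        rw [← hvq]; ring
      rw [e1]
      -- triangle inequalities
      have t1 : cosh (L - a) ≤ cosh c := by
        rw [cosh_le_cosh, abs_of_nonneg hc, abs_le]; constructor <;> linarith
      have t2 : cosh c ≤ cosh (L + a) := by
        rw [cosh_le_cosh, abs_of_nonneg hc, abs_of_nonneg (by positivity)]; exact h2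
      rw [cosh_sub] at t1
      rw [cosh_add] at t2
      have t3 : 0 ≤ (cosh c - (cosh L * cosh a - sinh L * sinh a)) *
        (cosh L * cosh a + sinh L * sinh a - cosh c) :=
        mul_nonneg (by linarith) (by linarith)
      have sa : sinh a ^ 2 = cosh a ^ 2 - 1 := by have := cosh_sq a; linarith
      have sL : sinh L ^ 2 = cosh L ^ 2 - 1 := by have := cosh_sq L; linarith
      have t4 : 0 ≤ (cosh L ^ 2 - 1) * (cosh a ^ 2 - 1) - (cosh c - cosh L * cosh a) ^ 2 := by
        rw [← sa, ← sL]; nlinarith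
      have hE : exp L ^ 2 = 2 * cosh L * exp L - 1 := by
        rw [cosh_eq, exp_neg]; field_simp; ring
      have : 4 * (exp L ^ 2 - 1) * q * cosh a - 4 * q ^ 2 - (exp L ^ 2 - 1) ^ 2
        = 4 * exp L ^ 2 * ((cosh L ^ 2 - 1) * (cosh a ^ 2 - 1) - (cosh c - cosh L * cosh a) ^ 2) := by
        rw [hq]
        have hp : exp L ≠ 0 := by positivity
        rw [cosh_eq L, exp_neg]
        field_simp
        ring
      rw [this]; positivity
    by_contra hcon
    push Not at hcon
    have : 0 < 4 * q ^ 2 := by positivity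
    nlinarith
  refine ⟨sqrt (2 * v * cosh a - 1 - v ^ 2), v, hvpos, ?_, ?_⟩
  · rw [sq_sqrt hu]; ring
  · rw [sq_sqrt hu]; rw [hq] at hvq; linarith

lemma hyp_cosh (u v l : ℝ) (hv : 0 < v) :
    Real.cosh (dist (⟨⟨u, v⟩, hv⟩ : UpperHalfPlane) ⟨⟨0, Real.exp l⟩, Real.exp_pos l⟩) =
      (u ^ 2 + v ^ 2 + Real.exp l ^ 2) / (2 * v * Real.exp l) := by
  rw [UpperHalfPlane.cosh_dist]
  have : dist (((⟨⟨u, v⟩, hv⟩ : UpperHalfPlane)) : ℂ) ((⟨⟨0, Real.exp l⟩, Real.exp_pos l⟩ : UpperHalfPlane) : ℂ) ^ 2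
    = u ^ 2 + (v - Real.exp l) ^ 2 := by
    rw [Complex.dist_eq, ← Complex.normSq_eq_norm_sq, Complex.normSq_apply]
    simp
    ring
  rw [this]
  show 1 + _ / (2 * v * Real.exp l) = _
  have := Real.exp_pos l
  field_simp
  ring

lemma hyp_vert (l m : ℝ) :
    dist (⟨⟨0, Real.exp l⟩, Real.exp_pos l⟩ : UpperHalfPlane) ⟨⟨0, Real.exp m⟩, Real.exp_pos m⟩
     = |l - m| := by
  rw [UpperHalfPlane.dist_of_re_eq (by rfl)]
  show dist (Real.log (Real.exp l)) (Real.log (Real.exp m)) = _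
  rw [Real.log_exp, Real.log_exp, Real.dist_eq]

/-- analytic comparison inequality -/
def CatStar (s : ℝ) (X : Type*) [MetricSpace X] : Prop :=
  ∀ x y z p : X, MetricBtw y p z →
    Real.cosh (s * dist x p) * Real.sinh (s * dist y z) ≤
      Real.cosh (s * dist x y) * Real.sinh (s * dist p z) +
      Real.cosh (s * dist x z) * Real.sinh (s * dist y p)

lemma star_of_cat {X : Type*} [MetricSpace X] (κ : ℝ) (hκ : κ < 0) (h : IsCatNeg κ X) :
    CatStar (Real.sqrt (-κ)) X := by
  intro x y z p hp
  have h := h y z x p x hp (by simp [MetricBtw])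
  set s := Real.sqrt (-κ) with hs
  have s0 : 0 < s := Real.sqrt_pos.2 (by linarith)
  rcases eq_or_ne y z with rfl | hyz
  · have h0 : dist y p = 0 := by
      have := hp; simp only [MetricBtw, dist_self] at this
      linarith [dist_nonneg (x := y) (y := p), dist_nonneg (x := p) (y := y)]
    have h1 : dist p y = 0 := by rw [dist_comm]; exact h0
    simp [h0, h1]
  have hL : 0 < s * dist y z := mul_pos s0 (dist_pos.2 hyz)
  obtain ⟨u, v, hv, e1, e2⟩ := hyp_triangle (s * dist y x) (s * dist x z) (s * dist y z)
    (by positivity) (by positivity) hL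
    (by rw [← mul_add]; gcongr; rw [dist_comm x z]; exact dist_triangle _ _ _)
    (by rw [← mul_add]; gcongr; rw [dist_comm x z, dist_comm y z]
        rw [dist_comm y x, dist_comm z x, dist_comm z y, add_comm]; exact dist_triangle _ _ _)
    (by rw [← mul_add]; gcongr; exact dist_triangle _ _ _)
  have hp' : dist p z = dist y z - dist y p := by
    have := hp; simp only [MetricBtw] at this; linarith
  have hle : dist y p ≤ dist y z := by linarith [dist_nonneg (x := p) (y := z)]
  set L := s * dist y z with hLd
  set l := s * dist y p with hld
  have hl0 : 0 ≤ l := by positivity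
  have hlL : l ≤ L := by rw [hld, hLd]; gcongr
  have v0 : (2 * v) ≠ 0 := by positivity
  have d1 : dist (⟨⟨u, v⟩, hv⟩ : UpperHalfPlane) ⟨⟨0, Real.exp 0⟩, Real.exp_pos 0⟩ = s * dist y x := by
    have : Real.cosh (dist (⟨⟨u, v⟩, hv⟩ : UpperHalfPlane) ⟨⟨0, Real.exp 0⟩, Real.exp_pos 0⟩) = Real.cosh (s * dist y x) := by
      rw [hyp_cosh, Real.exp_zero, one_pow, e1]; field_simp
    exact Real.cosh_injOn.eq_iff (by simp [dist_nonneg]) (by simp; positivity) |>.1 this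
  have d2 : dist (⟨⟨u, v⟩, hv⟩ : UpperHalfPlane) ⟨⟨0, Real.exp L⟩, Real.exp_pos L⟩ = s * dist x z := by
    have : Real.cosh (dist (⟨⟨u, v⟩, hv⟩ : UpperHalfPlane) ⟨⟨0, Real.exp L⟩, Real.exp_pos L⟩) = Real.cosh (s * dist x z) := by
      rw [hyp_cosh, e2]; field_simp
    exact Real.cosh_injOn.eq_iff (by simp [dist_nonneg]) (by simp; positivity) |>.1 this
  have h := h ⟨⟨0, Real.exp 0⟩, Real.exp_pos 0⟩ ⟨⟨0, Real.exp L⟩, Real.exp_pos L⟩ ⟨⟨u, v⟩, hv⟩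
    ⟨⟨0, Real.exp l⟩, Real.exp_pos l⟩ ⟨⟨u, v⟩, hv⟩
    (by rw [hyp_vert, zero_sub, abs_neg, abs_of_pos hL])
    (by rw [dist_comm]; exact d1)
    (by rw [dist_comm, d2, dist_comm x z])
    (by simp only [MetricBtw, hyp_vert, zero_sub, abs_neg, abs_of_pos hL, abs_of_nonneg hl0]
        rw [abs_sub_comm, abs_of_nonneg (by linarith)]; ring)
    (by rw [hyp_vert, zero_sub, abs_neg, abs_of_nonneg hl0])
    (by simp [MetricBtw]) (by rw [dist_comm]; exact d1)
  have hc : Real.cosh (s * dist x p) ≤ (u ^ 2 + v ^ 2 + Real.exp l ^ 2) / (2 * v * Real.exp l) := by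
    rw [← hyp_cosh u v l hv, Real.cosh_le_cosh, abs_of_nonneg (by positivity), abs_of_nonneg dist_nonneg,
      dist_comm x p, dist_comm _ (UpperHalfPlane.mk _ _)]
    exact h
  have hsL : 0 < Real.sinh L := by simpa using hL
  have e3 : s * dist p z = L - l := by rw [hp', hLd, hld]; ring
  rw [e3]
  refine (mul_le_mul_of_nonneg_right hc hsL.le).trans (le_of_eq ?_)
  rw [dist_comm x y, ← d1, ← d2, hyp_cosh, hyp_cosh, Real.exp_zero, Real.sinh_eq, Real.sinh_eq, Real.sinh_eq,
    neg_sub, Real.exp_sub, Real.exp_sub, Real.exp_neg, Real.exp_neg]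
  have := Real.exp_pos l
  have := Real.exp_pos L
  field_simp
  ring

def IsMid {X : Type*} [MetricSpace X] (y m z : X) : Prop :=
  dist y m = dist y z / 2 ∧ dist m z = dist y z / 2

lemma IsMid.symm {X : Type*} [MetricSpace X] {y m z : X} (h : IsMid y m z) : IsMid z m y := by
  obtain ⟨h1, h2⟩ := h
  refine ⟨?_, ?_⟩
  · rw [dist_comm z m, dist_comm z y]; exact h2
  · rw [dist_comm m y, dist_comm z y]; exact h1

lemma IsMid.btw {X : Type*} [MetricSpace X] {y m z : X} (h : IsMid y m z) : MetricBtw y m z := by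
  obtain ⟨h1, h2⟩ := h
  simp only [MetricBtw]; linarith

lemma star_mid {X : Type*} [MetricSpace X] {s : ℝ} (hs : 0 < s) (h : CatStar s X)
    {x o m y : X} (hm : IsMid o m y) :
    2 * Real.cosh (s * dist x m) * Real.cosh (s * dist o y / 2) ≤
      Real.cosh (s * dist x o) + Real.cosh (s * dist x y) := by
  rcases eq_or_ne o y with rfl | hne
  · have : o = m := by
      have := hm.1; rw [dist_self, zero_div] at this; exact dist_eq_zero.1 this
    subst this
    simp; linarith
  have h := h x o y m hm.btw
  have hL : 0 < s * dist o y / 2 := by have := dist_pos.2 hne; positivity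
  have e1 : s * dist o y = 2 * (s * dist o y / 2) := by ring
  have e2 : s * dist m y = s * dist o y / 2 := by rw [hm.2]; ring
  have e3 : s * dist o m = s * dist o y / 2 := by rw [hm.1]; ring
  rw [e2, e3, e1, Real.sinh_two_mul] at h
  rw [show 2 * (s * dist o y / 2) / 2 = s * dist o y / 2 by ring] at h
  have hp : 0 < Real.sinh (s * dist o y / 2) := by simpa using hL
  refine le_of_mul_le_mul_right ?_ hp
  linarith

open Real in
lemma real_mid (a b c d : ℝ) (ha : 0 ≤ a) (hb : 0 ≤ b) (hc : 0 ≤ c) (hd : 0 ≤ d)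
    (h1 : a ≤ b + c) (h2 : b ≤ a + c) (h3 : c ≤ a + b)
    (h : 4 * cosh d * cosh a * cosh b ≤ 2 * cosh b ^ 2 + cosh (2 * a) + cosh (2 * c)) : d ≤ c := by
  rw [cosh_two_mul, cosh_two_mul, sinh_sq, sinh_sq] at h
  have t1 : cosh (a - b) ≤ cosh c := by
    rw [cosh_le_cosh, abs_of_nonneg hc, abs_le]; constructor <;> linarith
  have t2 : cosh c ≤ cosh (a + b) := by
    rw [cosh_le_cosh, abs_of_nonneg hc, abs_of_nonneg (by positivity)]; exact h3
  rw [cosh_sub] at t1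
  rw [cosh_add] at t2
  have t3 : 0 ≤ (cosh c - (cosh a * cosh b - sinh a * sinh b)) *
    (cosh a * cosh b + sinh a * sinh b - cosh c) := mul_nonneg (by linarith) (by linarith)
  have sa := sinh_sq a
  have sb := sinh_sq b
  have t4 : 0 ≤ (cosh a ^ 2 - 1) * (cosh b ^ 2 - 1) - (cosh c - cosh a * cosh b) ^ 2 := by
    rw [← sa, ← sb]; nlinarith
  have : cosh d ≤ cosh c := by
    have hp : 0 < 4 * (cosh a * cosh b) := by have := cosh_pos a; have := cosh_pos b; positivity
    refine le_of_mul_le_mul_right ?_ hp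
    nlinarith
  rwa [cosh_le_cosh, abs_of_nonneg hc, abs_of_nonneg hd] at this

lemma mid_tri {X : Type*} [MetricSpace X] {s : ℝ} (hs : 0 < s) (h : CatStar s X)
    {o m y m' z : X} (hm : IsMid o m y) (hm' : IsMid o m' z) :
    dist m m' ≤ dist y z / 2 := by
  have i1 := star_mid hs h (x := m') hm
  have i2 := star_mid hs h (x := y) hm'
  have e1 : s * dist m' o = s * dist o z / 2 := by rw [dist_comm, hm'.1]; ring
  have key : s * dist m m' ≤ s * dist y z / 2 := by
    apply real_mid (s * dist o y / 2) (s * dist o z / 2) (s * dist y z / 2) (s * dist m m')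
      (by positivity) (by positivity) (by positivity) (by positivity)
    · have := dist_triangle o z y; rw [dist_comm z y] at this
      nlinarith
    · have := dist_triangle o y z
      nlinarith
    · have := dist_triangle y o z; rw [dist_comm y o] at this
      nlinarith
    · rw [e1] at i1
      rw [dist_comm m' m, dist_comm m' y] at i1
      rw [dist_comm y o] at i2
      rw [show 2 * (s * dist o y / 2) = s * dist o y by ring,
        show 2 * (s * dist y z / 2) = s * dist y z by ring]
      have := Real.cosh_pos (s * dist o z / 2)
      nlinarith
  have : s * dist m m' ≤ s * (dist y z / 2) := by linarith
  exact le_of_mul_le_mul_left this hs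

lemma exists_mid {X : Type*} [MetricSpace X] (hgeo : IsGeodesicSpace X) (x y : X) :
    ∃ m, IsMid x m y := by
  obtain ⟨p, hp, hb⟩ := hgeo x y (1/2) (by norm_num)
  simp only [MetricBtw] at hb
  exact ⟨p, by linarith, by linarith⟩

lemma mid_quad {X : Type*} [MetricSpace X] {s : ℝ} (hs : 0 < s) (h : CatStar s X)
    (hgeo : IsGeodesicSpace X)
    {a m b a' m' b' : X} (hm : IsMid a m b) (hm' : IsMid a' m' b') :
    dist m m' ≤ dist a a' / 2 + dist b b' / 2 := by
  obtain ⟨n, hn⟩ := exists_mid hgeo a b'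
  have h1 := mid_tri hs h hm hn
  have h2 := mid_tri hs h hn.symm hm'.symm
  linarith [dist_triangle m n m']

lemma exists_P {X : Type*} [MetricSpace X] {s : ℝ} (hs : 0 < s) (h : CatStar s X)
    (hgeo : IsGeodesicSpace X) (o : X) (k : ℕ) :
    ∃ P : X → X, (∀ y, MetricBtw o (P y) y) ∧ (∀ y, dist (P y) y = (1/2) ^ k * dist o y) ∧
      ∀ y z, dist (P y) (P z) ≤ (1 - (1/2) ^ k) * dist y z := by
  induction k with
  | zero =>
    refine ⟨fun _ => o, fun y => by simp [MetricBtw], fun y => by simp, fun y z => by simp⟩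
  | succ k ih =>
    obtain ⟨P, h1, h2, h3⟩ := ih
    choose Q hQ using fun y => exists_mid hgeo (P y) y
    have hd : ∀ y, dist (Q y) y = (1/2) ^ (k+1) * dist o y := by
      intro y
      rw [(hQ y).2, h2, pow_succ]; ring
    refine ⟨Q, fun y => ?_, hd, fun y z => ?_⟩
    · have a1 := h1 y
      have a2 := (hQ y).1
      have a3 := (hQ y).2
      simp only [MetricBtw] at a1 ⊢
      have := dist_triangle o (P y) (Q y)
      have := dist_triangle o (Q y) y
      linarith
    · have := mid_quad hs h hgeo (hQ y) (hQ z)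
      have := h3 y z
      rw [pow_succ]; linarith

lemma exists_approx {X : Type*} [MetricSpace X] [CompleteSpace X] {s : ℝ} (hs : 0 < s)
    (h : CatStar s X) (hgeo : IsGeodesicSpace X) (K : Set X) (hcl : IsClosed K)
    (hconv : MetricConvex K) (T : X → X) (hT : Set.MapsTo T K K)
    (hn : ∀ x ∈ K, ∀ y ∈ K, dist (T x) (T y) ≤ dist x y) (o : X) (ho : o ∈ K) (k : ℕ) :
    ∃ x ∈ K, MetricBtw o x (T x) ∧ dist x (T x) = (1/2) ^ k * dist o (T x) := by
  obtain ⟨P, h1, h2, h3⟩ := exists_P hs h hgeo o k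
  have hm : Set.MapsTo (fun x => P (T x)) K K := fun x hx => hconv o ho _ (hT hx) _ (h1 _)
  have hk : (0:ℝ) < (1/2) ^ k := by positivity
  have hk1 : ((1:ℝ)/2) ^ k ≤ 1 := pow_le_one₀ (by norm_num) (by norm_num)
  have hc : ContractingWith (⟨1 - (1/2) ^ k, by linarith⟩ : NNReal) (hm.restrict _ K K) := by
    refine ⟨?_, ?_⟩
    · refine NNReal.coe_lt_coe.1 ?_; show 1 - ((1:ℝ)/2) ^ k < 1; linarith
    · apply LipschitzWith.of_dist_le_mul
      rintro ⟨x, hx⟩ ⟨y, hy⟩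
      show dist (P (T x)) (P (T y)) ≤ (1 - ((1:ℝ)/2) ^ k) * dist x y
      refine (h3 _ _).trans ?_
      exact mul_le_mul_of_nonneg_left (hn x hx y hy) (by linarith)
  obtain ⟨x, hx, hf, -⟩ := hc.exists_fixedPoint' hcl.isComplete hm ho (edist_ne_top _ _)
  have hf : P (T x) = x := hf
  refine ⟨x, hx, ?_, ?_⟩
  · have := h1 (T x); rwa [hf] at this
  · have := h2 (T x); rwa [hf] at this

open Real in
lemma real_main (r ρ α β cd cc e M : ℝ) (hr : 0 ≤ r) (hρ : 0 ≤ ρ) (hα : 0 < α) (hβ : 0 < β)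
    (hcc : cc ≤ cd) (hcd : 0 ≤ cd)
    (h1 : cd * sinh (r + α) ≤ cosh ρ * sinh α + e * sinh r)
    (h2 : e * sinh (ρ + β) ≤ cosh (r + α) * sinh β + cc * sinh ρ)
    (hM1 : cosh ρ ≤ M * cosh r) (hM2 : cosh (r + α) ≤ M * cosh ρ) : cd ≤ M := by
  have sα : 0 < sinh α := by simpa using hα
  have sβ : 0 < sinh β := by simpa using hβ
  have sr : 0 ≤ sinh r := by simpa using hr
  have sρ : 0 ≤ sinh ρ := by simpa using hρ
  have sb : 0 < sinh (ρ + β) := by simp; positivity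
  have cr := cosh_pos r
  have cρ := cosh_pos ρ
  have g1 : sinh r + sinh α * cosh r ≤ sinh (r + α) := by
    rw [sinh_add]; nlinarith [one_le_cosh α]
  have g2 : sinh ρ + sinh β * cosh ρ ≤ sinh (ρ + β) := by
    rw [sinh_add]; nlinarith [one_le_cosh β]
  have k1 : cd * sinh (r + α) * sinh (ρ + β) ≤ cosh ρ * sinh α * sinh (ρ + β) +
      (cosh (r + α) * sinh β + cc * sinh ρ) * sinh r := by
    have := mul_le_mul_of_nonneg_right h1 sb.le
    have := mul_le_mul_of_nonneg_right h2 sr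
    linarith
  have k2 : cd * (sinh r + sinh α * cosh r) * sinh (ρ + β) ≤ cd * sinh (r + α) * sinh (ρ + β) := by
    gcongr
  have k3 : cd * sinh r * (sinh ρ + sinh β * cosh ρ) ≤ cd * sinh r * sinh (ρ + β) := by gcongr
  have k4 : cc * sinh ρ * sinh r ≤ cd * sinh ρ * sinh r := by gcongr
  have k5 : cosh ρ * (sinh α * sinh (ρ + β)) ≤ M * cosh r * (sinh α * sinh (ρ + β)) := by gcongr
  have k6 : cosh (r + α) * (sinh β * sinh r) ≤ M * cosh ρ * (sinh β * sinh r) := by gcongr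
  have hp : 0 < sinh α * cosh r * sinh (ρ + β) + sinh r * sinh β * cosh ρ := by positivity
  refine le_of_mul_le_mul_right ?_ hp
  linarith

lemma main_est {X : Type*} [MetricSpace X] {s : ℝ} (hs : 0 < s) (h : CatStar s X)
    {o x y x' y' : X} (hx : MetricBtw o x x') (hy : MetricBtw o y y') (hxx : x ≠ x') (hyy : y ≠ y')
    (hle : dist x' y' ≤ dist x y) (M : ℝ)
    (hM1 : Real.cosh (s * dist o y) ≤ M * Real.cosh (s * dist o x))
    (hM2 : Real.cosh (s * dist o x') ≤ M * Real.cosh (s * dist o y)) :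
    Real.cosh (s * dist x y) ≤ M := by
  have e1 : s * dist o x' = s * dist o x + s * dist x x' := by rw [← mul_add, hx]
  have e2 : s * dist o y' = s * dist o y + s * dist y y' := by rw [← mul_add, hy]
  have i1 := h y o x' x hx
  have i2 := h x' o y' y hy
  rw [e1] at hM2 i1
  rw [dist_comm x' o, e1, e2] at i2
  rw [dist_comm y o, dist_comm y x] at i1
  rw [dist_comm x' y] at i2
  refine real_main _ _ (s * dist x x') (s * dist y y') _ (Real.cosh (s * dist x' y')) _ M
    (by positivity) (by positivity)
    (mul_pos hs (dist_pos.2 hxx)) (mul_pos hs (dist_pos.2 hyy)) ?_ (Real.cosh_pos _).le i1 i2 hM1 hM2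
  rw [Real.cosh_le_cosh, abs_of_nonneg (by positivity), abs_of_nonneg (by positivity)]
  gcongr

open Real in
lemma real_ray (u r ρ cd e P E : ℝ) (hu : 0 ≤ u) (hr : 0 < r) (hrρ : r ≤ ρ) (hE : 0 ≤ E)
    (h1 : P * sinh r ≤ cosh u * sinh (r - u) + e * sinh u)
    (h2 : e * sinh ρ ≤ cosh r * sinh (ρ - u) + cd * sinh u)
    (h3 : cd * cosh r ≤ E * cosh ρ) :
    P ≤ exp (-u) * cosh u + sinh u * ((1 + (sinh r)⁻¹) * exp (-u) + sinh u * E * ((sinh r)⁻¹) ^ 2) := by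
  have aux : ∀ t, sinh (t - u) ≤ exp (-u) * sinh t := by
    intro t
    rw [sinh_sub, ← cosh_sub_sinh u]
    nlinarith [show 0 ≤ sinh u by simpa using hu, sinh_lt_cosh t]
  have sr : 0 < sinh r := by simpa using hr
  have sρ : 0 < sinh ρ := by simp; linarith
  have su : 0 ≤ sinh u := by simpa using hu
  have cr := cosh_pos r
  have cu := cosh_pos u
  have hcoth : cosh ρ * sinh r ≤ cosh r * sinh ρ := by
    have : 0 ≤ sinh (ρ - r) := by simp; linarith
    rw [sinh_sub] at this; linarith
  have c1 : cd * sinh r ≤ E * sinh ρ := by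
    refine le_of_mul_le_mul_right ?_ cr
    nlinarith
  have e1 : e * sinh r ≤ cosh r * exp (-u) * sinh r + sinh u * E := by
    refine le_of_mul_le_mul_right ?_ sρ
    have a1 := mul_le_mul_of_nonneg_right h2 sr.le
    have a2 := mul_le_mul_of_nonneg_left (aux ρ) (mul_pos cr sr).le
    have a3 := mul_le_mul_of_nonneg_right c1 su
    linarith
  have hcs : cosh r ≤ sinh r + 1 := by
    have := cosh_sub_sinh r
    have : exp (-r) ≤ 1 := by simpa using hr.le
    linarith
  have f1 : P * sinh r ^ 2 ≤ (exp (-u) * cosh u) * sinh r ^ 2 +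
      sinh u * ((sinh r + 1) * exp (-u) * sinh r + sinh u * E) := by
    have a1 := mul_le_mul_of_nonneg_right h1 sr.le
    have a2 := mul_le_mul_of_nonneg_left (aux r) (mul_pos cu sr).le
    have a3 := mul_le_mul_of_nonneg_right e1 su
    have a4 : cosh r * (exp (-u) * sinh r * sinh u) ≤ (sinh r + 1) * (exp (-u) * sinh r * sinh u) := by
      gcongr
    linarith
  refine le_of_mul_le_mul_right (f1.trans (le_of_eq ?_)) (by positivity : 0 < sinh r ^ 2)
  field_simp

lemma ray_est {X : Type*} [MetricSpace X] {s : ℝ} (hs : 0 < s) (h : CatStar s X)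
    {o x y p q : X} (hp : MetricBtw o p x) (hq : MetricBtw o q y) (hpq : dist o p = dist o q)
    (hx : 0 < dist o x) (hxy : dist o x ≤ dist o y) (E : ℝ) (hE : 0 ≤ E)
    (h3 : Real.cosh (s * dist x y) * Real.cosh (s * dist o x) ≤ E * Real.cosh (s * dist o y)) :
    Real.cosh (s * dist p q) ≤ Real.exp (-(s * dist o p)) * Real.cosh (s * dist o p) +
      Real.sinh (s * dist o p) * ((1 + (Real.sinh (s * dist o x))⁻¹) * Real.exp (-(s * dist o p)) +
       Real.sinh (s * dist o p) * E * ((Real.sinh (s * dist o x))⁻¹) ^ 2) := by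
  have e1 : s * dist p x = s * dist o x - s * dist o p := by rw [← hp]; ring
  have e2 : s * dist q y = s * dist o y - s * dist o p := by rw [← hq, hpq]; ring
  have i1 := h q o x p hp
  have i2 := h x o y q hq
  rw [e1, dist_comm q o, ← hpq, dist_comm q p] at i1
  rw [e2, ← hpq, dist_comm x o, dist_comm x q] at i2
  exact real_ray _ _ (s * dist o y) _ _ _ E (by positivity) (by positivity) (by gcongr) hE i1 i2 h3

lemma same_seg {X : Type*} [MetricSpace X] {s : ℝ} (hs : 0 < s) (h : CatStar s X)
    {o x p q : X} (hp : MetricBtw o p x) (hq : MetricBtw o q x) :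
    dist p q = |dist o p - dist o q| := by
  apply le_antisymm
  · rcases eq_or_ne o x with rfl | hne
    · simp only [MetricBtw, dist_self] at hp hq
      have a1 := dist_nonneg (x := o) (y := p)
      have a2 := dist_nonneg (x := o) (y := q)
      have a3 := dist_triangle p o q
      rw [dist_comm p o] at a3 hp
      rw [dist_comm q o] at hq
      linarith [abs_nonneg (dist o p - dist o q)]
    have i1 := h q o x p hp
    have e1 : s * dist p x = s * dist o x - s * dist o p := by rw [← hp]; ring
    have e2 : s * dist q x = s * dist o x - s * dist o q := by rw [← hq]; ring
    rw [e1, e2, dist_comm q o, dist_comm q p] at i1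
    have e3 : Real.cosh (s * dist o q) * Real.sinh (s * dist o x - s * dist o p) +
      Real.cosh (s * dist o x - s * dist o q) * Real.sinh (s * dist o p) =
      Real.cosh (s * dist o p - s * dist o q) * Real.sinh (s * dist o x) := by
      rw [Real.sinh_sub, Real.cosh_sub, Real.cosh_sub]; ring
    rw [e3] at i1
    have sp : 0 < Real.sinh (s * dist o x) := by
      have := dist_pos.2 hne; simp; positivity
    have := le_of_mul_le_mul_right i1 sp
    rw [Real.cosh_le_cosh, abs_of_nonneg (by positivity), ← mul_sub, abs_mul, abs_of_pos hs] at this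
    exact le_of_mul_le_mul_left this hs
  · rw [dist_comm o p, dist_comm o q]
    exact abs_dist_sub_le p q o

lemma cauchy_of_cosh {X : Type*} [MetricSpace X] {s : ℝ} (hs : 0 < s) (f : ℕ → X)
    (h : ∀ M > 1, ∃ N, ∀ m ≥ N, ∀ n ≥ N, Real.cosh (s * dist (f m) (f n)) ≤ M) :
    CauchySeq f := by
  rw [Metric.cauchySeq_iff]
  intro ε hε
  obtain ⟨N, hN⟩ := h (Real.cosh (s * (ε / 2))) (by rw [gt_iff_lt, Real.one_lt_cosh]; positivity)
  refine ⟨N, fun m hm n hn => ?_⟩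
  have := hN m hm n hn
  rw [Real.cosh_le_cosh, abs_of_nonneg (by positivity), abs_of_nonneg (by positivity)] at this
  have := le_of_mul_le_mul_left this hs
  linarith

open Filter Topology in
lemma bounded_case {X : Type*} [MetricSpace X] [CompleteSpace X] {s : ℝ} (hs : 0 < s)
    (h : CatStar s X) (K : Set X) (hcl : IsClosed K)
    (T : X → X) (hn : ∀ x ∈ K, ∀ y ∈ K, dist (T x) (T y) ≤ dist x y) (hT : Set.MapsTo T K K)
    (hfix : ∀ z ∈ K, T z ≠ z)
    (o : X) (x : ℕ → X) (hxK : ∀ n, x n ∈ K) (hb : ∀ n, MetricBtw o (x n) (T (x n)))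
    (r : ℝ) (hr : Tendsto (fun n => dist o (x n)) atTop (𝓝 r))
    (ha : Tendsto (fun n => dist (x n) (T (x n))) atTop (𝓝 0)) : False := by
  have hr' : Tendsto (fun n => dist o (T (x n))) atTop (𝓝 r) := by
    have := hr.add ha
    rw [add_zero] at this
    exact this.congr (fun n => hb n)
  have hc : Continuous fun t => Real.cosh (s * t) := by fun_prop
  have f1 : Tendsto (fun n => Real.cosh (s * dist o (x n))) atTop (𝓝 (Real.cosh (s * r))) :=
    (hc.tendsto r).comp hr
  have f2 : Tendsto (fun n => Real.cosh (s * dist o (T (x n)))) atTop (𝓝 (Real.cosh (s * r))) :=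
    (hc.tendsto r).comp hr'
  have cp := Real.cosh_pos (s * r)
  have hC : CauchySeq x := by
    apply cauchy_of_cosh hs
    intro M hM
    set a := Real.sqrt M with hadef
    have ha2 : a * a = M := Real.mul_self_sqrt (by linarith)
    have ha1 : 1 < a := by rw [hadef, Real.lt_sqrt (by norm_num)]; simpa using hM
    have l1 : Real.cosh (s * r) < a * Real.cosh (s * r) := by nlinarith
    have l2 : Real.cosh (s * r) / a < Real.cosh (s * r) := by
      rw [div_lt_iff₀ (by linarith)]; nlinarith
    obtain ⟨N, hN⟩ := eventually_atTop.1
      ((f1.eventually (gt_mem_nhds l1)).and ((f1.eventually (lt_mem_nhds l2)).and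
        (f2.eventually (gt_mem_nhds l1))))
    refine ⟨N, fun m hm n hn' => ?_⟩
    obtain ⟨p1, p2, p3⟩ := hN m hm
    obtain ⟨q1, q2, q3⟩ := hN n hn'
    rw [div_lt_iff₀ (by linarith)] at p2 q2
    refine main_est hs h (hb m) (hb n) (hfix _ (hxK m)).symm (hfix _ (hxK n)).symm
      (hn _ (hxK m) _ (hxK n)) M ?_ ?_
    · rw [← ha2]; nlinarith
    · rw [← ha2]; nlinarith
  obtain ⟨z, hz⟩ := cauchySeq_tendsto_of_complete hC
  have hzK : z ∈ K := hcl.mem_of_tendsto hz (Eventually.of_forall hxK)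
  apply hfix z hzK
  have d0 : Tendsto (fun n => dist (x n) z) atTop (𝓝 0) := tendsto_iff_dist_tendsto_zero.1 hz
  have lim : Tendsto (fun n => dist (x n) z + dist (x n) (T (x n)) + dist (x n) z) atTop (𝓝 0) := by
    have := (d0.add ha).add d0
    simpa using this
  have : dist (T z) z ≤ 0 := by
    refine ge_of_tendsto lim (Eventually.of_forall fun n => ?_)
    have a1 := hn _ (hxK n) z hzK
    have a2 := dist_triangle4 (T z) (T (x n)) (x n) z
    rw [dist_comm (T z) (T (x n)), dist_comm (T (x n)) (x n)] at a2
    linarith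
  exact dist_le_zero.1 this

open Filter Topology in
lemma unbounded_case {X : Type*} [MetricSpace X] [CompleteSpace X] {s : ℝ} (hs : 0 < s)
    (h : CatStar s X) (hgeo : IsGeodesicSpace X) (K : Set X) (hcl : IsClosed K)
    (hconv : MetricConvex K)
    (T : X → X) (hn : ∀ x ∈ K, ∀ y ∈ K, dist (T x) (T y) ≤ dist x y)
    (hfix : ∀ z ∈ K, T z ≠ z)
    (o : X) (ho : o ∈ K) (x : ℕ → X) (hxK : ∀ n, x n ∈ K) (hb : ∀ n, MetricBtw o (x n) (T (x n)))
    (δ : ℝ) (hδ0 : 0 ≤ δ) (hδ : ∀ n, dist (x n) (T (x n)) ≤ δ)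
    (hr : Tendsto (fun n => dist o (x n)) atTop atTop) : ¬ GeodesicallyBounded K := by
  have hq : ∀ n : ℕ, ∀ u : ℝ, ∃ q : X, 0 ≤ u → u ≤ dist o (x n) →
      dist o q = u ∧ MetricBtw o q (x n) := by
    intro n u
    by_cases hu : 0 ≤ u ∧ u ≤ dist o (x n)
    · rcases eq_or_lt_of_le (dist_nonneg (x := o) (y := x n)) with h0 | h0
      · refine ⟨o, fun _ _ => ⟨?_, by simp [MetricBtw]⟩⟩
        rw [dist_self]; linarith [hu.1, hu.2]
      · obtain ⟨p, hp, hb⟩ := hgeo o (x n) (u / dist o (x n))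
          ⟨div_nonneg hu.1 h0.le, (div_le_one h0).2 hu.2⟩
        exact ⟨p, fun _ _ => ⟨by rw [hp]; field_simp, hb⟩⟩
    · exact ⟨o, fun a b => absurd ⟨a, b⟩ hu⟩
  choose q hq using hq
  set E := Real.exp (s * δ) with hEdef
  have hE : 1 ≤ E := Real.one_le_exp (by positivity)
  have hd : ∀ m n, dist o (x m) ≤ dist o (x n) →
      Real.cosh (s * dist (x m) (x n)) * Real.cosh (s * dist o (x m)) ≤
        E * Real.cosh (s * dist o (x n)) := by
    intro m n hmn
    have c1 := Real.cosh_pos (s * dist o (x m))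
    have c2 := Real.cosh_pos (s * dist o (x n))
    rw [← le_div_iff₀ c1]
    have c3 : Real.cosh (s * dist o (x m)) ≤ Real.cosh (s * dist o (x n)) := by
      rw [Real.cosh_le_cosh, abs_of_nonneg (by positivity), abs_of_nonneg (by positivity)]
      gcongr
    refine main_est hs h (hb m) (hb n) (hfix _ (hxK m)).symm (hfix _ (hxK n)).symm
      (hn _ (hxK m) _ (hxK n)) _ ?_ ?_
    · rw [div_mul_cancel₀ _ c1.ne']; nlinarith
    · have e1 : s * dist o (T (x m)) = s * dist o (x m) + s * dist (x m) (T (x m)) := by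
        rw [← mul_add, hb m]
      have g1 : Real.cosh (s * dist o (T (x m))) ≤ E * Real.cosh (s * dist o (x m)) := by
        rw [e1, Real.cosh_add]
        have a1 : Real.exp (s * dist (x m) (T (x m))) ≤ E := by
          rw [hEdef, Real.exp_le_exp]; gcongr; exact hδ m
        rw [← Real.cosh_add_sinh] at a1
        have a2 := (Real.sinh_lt_cosh (s * dist o (x m))).le
        have a3 : 0 ≤ Real.sinh (s * dist (x m) (T (x m))) := by
          rw [Real.sinh_nonneg_iff]; positivity
        nlinarith
      refine g1.trans ?_
      rw [div_mul_eq_mul_div, le_div_iff₀ c1, mul_assoc, mul_assoc]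
      gcongr
  have hC : ∀ u, 0 ≤ u → CauchySeq (fun n => q n u) := by
    intro u hu
    apply cauchy_of_cosh hs
    intro M hM
    set F : ℝ → ℝ := fun w => Real.exp (-(s * u)) * Real.cosh (s * u) +
      Real.sinh (s * u) * ((1 + w) * Real.exp (-(s * u)) +
       Real.sinh (s * u) * E * w ^ 2) with hF
    have F0 : F 0 = 1 := by
      simp only [hF]
      have : Real.exp (-(s * u)) * Real.exp (s * u) = 1 := by
        rw [← Real.exp_add]; simp
      rw [← Real.cosh_add_sinh (s * u)] at this
      linarith
    have hFc : Continuous F := by fun_prop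
    have hw : Tendsto (fun n => (Real.sinh (s * dist o (x n)))⁻¹) atTop (𝓝 0) := by
      apply Tendsto.inv_tendsto_atTop
      refine tendsto_atTop_mono (fun n => ?_) (hr.const_mul_atTop hs)
      rw [Real.self_le_sinh_iff]; positivity
    have hFt := (hFc.tendsto 0).comp hw
    rw [F0] at hFt
    obtain ⟨N, hN⟩ := eventually_atTop.1 ((hFt.eventually (gt_mem_nhds hM)).and
      (hr.eventually (eventually_ge_atTop (u + 1))))
    have main : ∀ m ≥ N, ∀ n ≥ N, dist o (x m) ≤ dist o (x n) →
        Real.cosh (s * dist (q m u) (q n u)) ≤ M := by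
      intro m hm n hn' hmn
      obtain ⟨a1, a2⟩ := hN m hm
      obtain ⟨b1, b2⟩ := hN n hn'
      obtain ⟨c1, c2⟩ := hq m u hu (by linarith)
      obtain ⟨d1, d2⟩ := hq n u hu (by linarith)
      have := ray_est hs h c2 d2 (by rw [c1, d1]) (by linarith) hmn E (by linarith) (hd m n hmn)
      rw [c1] at this
      exact this.trans a1.le
    refine ⟨N, fun m hm n hn' => ?_⟩
    rcases le_total (dist o (x m)) (dist o (x n)) with hmn | hmn
    · exact main m hm n hn' hmn
    · rw [dist_comm]; exact main n hn' m hm hmn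
  have hlim : ∀ u : ℝ, ∃ z, 0 ≤ u → Tendsto (fun n => q n u) atTop (𝓝 z) := by
    intro u
    by_cases hu : 0 ≤ u
    · obtain ⟨z, hz⟩ := cauchySeq_tendsto_of_complete (hC u hu)
      exact ⟨z, fun _ => hz⟩
    · exact ⟨o, fun a => absurd a hu⟩
  choose c hc using hlim
  intro hG
  refine hG ⟨c, fun u v hu hv => ?_, fun u hu => ?_⟩
  · have l1 := (hc u hu).dist (hc v hv)
    refine tendsto_nhds_unique l1 (tendsto_const_nhds.congr' ?_)
    filter_upwards [hr.eventually (eventually_ge_atTop u), hr.eventually (eventually_ge_atTop v)]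
      with n h1 h2
    obtain ⟨c1, c2⟩ := hq n u hu h1
    obtain ⟨d1, d2⟩ := hq n v hv h2
    rw [same_seg hs h c2 d2, c1, d1]
  · refine hcl.mem_of_tendsto (hc u hu) ?_
    filter_upwards [hr.eventually (eventually_ge_atTop u)] with n h1
    exact hconv o ho _ (hxK n) _ (hq n u hu h1).2

open Filter Topology in
lemma fpp_of_bounded {X : Type*} [MetricSpace X] [CompleteSpace X] {s : ℝ} (hs : 0 < s)
    (h : CatStar s X) (hgeo : IsGeodesicSpace X) (K : Set X) (hne : K.Nonempty) (hcl : IsClosed K)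
    (hconv : MetricConvex K) (hG : GeodesicallyBounded K)
    (T : X → X) (hT : Set.MapsTo T K K)
    (hn : ∀ x ∈ K, ∀ y ∈ K, dist (T x) (T y) ≤ dist x y) : ∃ z ∈ K, T z = z := by
  by_contra hfix
  push Not at hfix
  obtain ⟨o, ho⟩ := hne
  choose x hxK hb hd using exists_approx hs h hgeo K hcl hconv T hT hn o ho
  have hδ : ∀ n, dist (x n) (T (x n)) ≤ dist o (T o) := by
    intro n
    have a1 := hb n
    have a2 := hn o ho _ (hxK n)
    have a3 := dist_triangle o (T o) (T (x n))
    simp only [MetricBtw] at a1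
    linarith
  by_cases hr : Tendsto (fun n => dist o (x n)) atTop atTop
  · exact unbounded_case hs h hgeo K hcl hconv T hn hfix o ho x hxK hb _ dist_nonneg hδ hr hG
  · rw [tendsto_atTop] at hr
    push Not at hr
    obtain ⟨C, hC⟩ := hr
    have hC : ∃ᶠ n in atTop, dist o (x n) ≤ C := by
      refine fun hcon => hC ?_
      filter_upwards [hcon] with n hn'
      linarith [not_le.1 hn']
    obtain ⟨φ, hφ, hφC⟩ := extraction_of_frequently_atTop hC
    obtain ⟨r, -, ψ, hψ, hr⟩ := (isCompact_Icc (a := (0:ℝ)) (b := C)).tendsto_subseq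
      (x := fun n => dist o (x (φ n))) (fun n => ⟨dist_nonneg, hφC n⟩)
    refine bounded_case hs h K hcl T hn hT hfix o (fun n => x (φ (ψ n))) (fun n => hxK _)
      (fun n => hb _) r hr ?_
    have p0 : Tendsto (fun n => ((1:ℝ)/2) ^ (φ (ψ n)) * (C + dist o (T o))) atTop (𝓝 0) := by
      have := ((tendsto_pow_atTop_nhds_zero_of_lt_one (r := (1:ℝ)/2) (by norm_num)
        (by norm_num)).comp ((hφ.comp hψ).tendsto_atTop)).mul_const (C + dist o (T o))
      simpa using this
    refine squeeze_zero (fun _ => dist_nonneg) (fun n => ?_) p0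
    rw [hd]
    gcongr
    rw [← hb]
    exact add_le_add (hφC _) (hδ _)

lemma bounded_of_fpp {X : Type*} [MetricSpace X] (K : Set X)
    (h : ∀ T : X → X, Set.MapsTo T K K →
      (∀ x ∈ K, ∀ y ∈ K, dist (T x) (T y) ≤ dist x y) → ∃ z ∈ K, T z = z) :
    GeodesicallyBounded K := by
  rintro ⟨c, hc, hK⟩
  -- Busemann function
  set f : X → ℝ := fun x => ⨆ t : Set.Ici (0:ℝ), ((t:ℝ) - dist x (c t)) with hf
  have hbdd : ∀ x, BddAbove (Set.range fun t : Set.Ici (0:ℝ) => ((t:ℝ) - dist x (c t))) := by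
    intro x
    refine ⟨dist x (c 0), ?_⟩
    rintro _ ⟨⟨t, ht⟩, rfl⟩
    have ht : 0 ≤ t := ht
    have a1 := hc 0 t le_rfl ht
    rw [zero_sub, abs_neg, abs_of_nonneg ht] at a1
    have a2 := dist_triangle (c 0) x (c t)
    rw [dist_comm (c 0) x] at a2
    simp only
    linarith
  haveI : Nonempty (Set.Ici (0:ℝ)) := ⟨⟨0, by simp⟩⟩
  have hle : ∀ x y, f x ≤ f y + dist x y := by
    intro x y
    refine ciSup_le fun t => ?_
    have a1 := le_ciSup (hbdd y) t
    have a2 := dist_triangle y x (c t)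
    rw [dist_comm y x] at a2
    simp only [hf] at a1 ⊢
    linarith
  have hfc : ∀ u, 0 ≤ u → f (c u) = u := by
    intro u hu
    apply le_antisymm
    · refine ciSup_le fun t => ?_
      rw [hc u t hu t.2]
      have := neg_abs_le (u - t)
      linarith
    · have a1 := le_ciSup (hbdd (c u)) ⟨u, hu⟩
      simpa using a1
  obtain ⟨z, hzK, hz⟩ := h (fun x => c (max 0 (f x) + 1))
    (fun x _ => hK _ (by positivity)) (fun x _ y _ => by
      rw [hc _ _ (by positivity) (by positivity)]
      have : |max 0 (f x) + 1 - (max 0 (f y) + 1)| ≤ |f x - f y| := by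
        rw [add_sub_add_right_eq_sub]
        have := abs_max_sub_max_le_max 0 (f x) 0 (f y)
        simpa using this
      refine this.trans (abs_le.2 ⟨?_, ?_⟩)
      · have := hle y x; rw [dist_comm y x] at this; linarith
      · have := hle x y; linarith)
  have hz : c (max 0 (f z) + 1) = z := hz
  have h1 := hfc (max 0 (f z) + 1) (by positivity)
  rw [hz] at h1
  have : max 0 (f z) = f z := max_eq_right (by rw [h1]; positivity)
  linarith

/-- A nonempty closed convex subset `K` of a complete CAT(κ) space with `κ < 0`
has the fixed point property for nonexpansive mappings `T : K → K` if and only if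
`K` is geodesically bounded. -/
theorem catK_fpp_iff_geodesically_bounded {X : Type*} [MetricSpace X]
    [CompleteSpace X] (κ : ℝ) (hκ : κ < 0)
    (hgeo : IsGeodesicSpace X) (hcat : IsCatK κ X)
    (K : Set X) (hne : K.Nonempty) (hcl : IsClosed K) (hconv : MetricConvex K) :
    (∀ T : X → X, Set.MapsTo T K K →
      (∀ x ∈ K, ∀ y ∈ K, dist (T x) (T y) ≤ dist x y) → ∃ z ∈ K, T z = z) ↔
    GeodesicallyBounded K := by
  have hs : 0 < Real.sqrt (-κ) := Real.sqrt_pos.2 (by linarith)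
  rw [IsCatK, if_pos hκ] at hcat
  exact ⟨bounded_of_fpp K, fun hG T hT hn =>
    fpp_of_bounded hs (star_of_cat κ hκ hcat) hgeo K hne hcl hconv hG T hT hn⟩
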